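/- arXiv:1409.4524 — 2 statements merged into one kernel-verified Lean document; each statement's English description precedes it below -/
import Mathlib

section
/- Let v be a Barabanov norm for the linear switched system associated with M. A solution x of the switched system is v-extremal if and only if x admits a measurable switching signal A(·) with values in M such that x'(t) = A(t)x(t) for almost every t ≥ 0 and, for almost every t ≥ 0, there exists l ∈ ∂v(x(t)) with lᵀA(t)x(t) = 0 and lᵀB x(t) ≤ 0 for every B ∈ M. -/
open MeasureTheory Filter Topology RealInnerProductSpace Matrix

noncomputable section

abbrev Vec (n : ℕ) := EuclideanSpace ℝ (Fin n)

def mulE {n : ℕ} (A : Matrix (Fin n) (Fin n) ℝ) (y : Vec n) : Vec n :=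
  Matrix.toEuclideanLin A y

def IsSolutionWith {n : ℕ} (M : Set (Matrix (Fin n) (Fin n) ℝ))
    (A : ℝ → Matrix (Fin n) (Fin n) ℝ) (x : ℝ → Vec n) : Prop :=
  (∀ i j, Measurable fun t => A t i j) ∧ (∀ t, A t ∈ M) ∧
    ContinuousOn x (Set.Ici 0) ∧
    ∀ t ≥ (0:ℝ), x t = x 0 + ∫ s in (0:ℝ)..t, mulE (A s) (x s)

def IsSolution {n : ℕ} (M : Set (Matrix (Fin n) (Fin n) ℝ)) (x : ℝ → Vec n) : Prop :=
  ∃ A, IsSolutionWith M A x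

def IsAdjointWith {n : ℕ} (A : ℝ → Matrix (Fin n) (Fin n) ℝ) (l : ℝ → Vec n) : Prop :=
  ContinuousOn l (Set.Ici 0) ∧
    ∀ t ≥ (0:ℝ), l t = l 0 - ∫ s in (0:ℝ)..t, mulE ((A s)ᵀ) (l s)

def IsNorm {n : ℕ} (v : Vec n → ℝ) : Prop :=
  (∀ x, v x = 0 ↔ x = 0) ∧ (∀ (a : ℝ) (x : Vec n), v (a • x) = |a| * v x) ∧
    ∀ x y, v (x + y) ≤ v x + v y

def IsBarabanov {n : ℕ} (M : Set (Matrix (Fin n) (Fin n) ℝ)) (v : Vec n → ℝ) : Prop :=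
  IsNorm v ∧ (∀ x, IsSolution M x → ∀ t ≥ (0:ℝ), v (x t) ≤ v (x 0)) ∧
    ∀ y : Vec n, ∃ x, IsSolution M x ∧ x 0 = y ∧ ∀ t ≥ (0:ℝ), v (x t) = v y

def IsExtremal {n : ℕ} (M : Set (Matrix (Fin n) (Fin n) ℝ)) (v : Vec n → ℝ)
    (x : ℝ → Vec n) : Prop :=
  IsSolution M x ∧ ∀ t ≥ (0:ℝ), v (x t) = v (x 0)

def subdiff {n : ℕ} (v : Vec n → ℝ) (x : Vec n) : Set (Vec n) :=
  {l | ⟪l, x⟫ = v x ∧ ∀ y, ⟪l, y⟫ ≤ v y}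

def MIrreducible {n : ℕ} (M : Set (Matrix (Fin n) (Fin n) ℝ)) : Prop :=
  ∀ W : Submodule ℝ (Vec n), (∀ A ∈ M, ∀ x ∈ W, mulE A x ∈ W) → W = ⊥ ∨ W = ⊤

def rhoZero {n : ℕ} (M : Set (Matrix (Fin n) (Fin n) ℝ)) : Prop :=
  sSup {r : EReal | ∃ x, IsSolution M x ∧ x 0 ≠ 0 ∧
      r = limsup (fun t => ((Real.log ‖x t‖ / t : ℝ) : EReal)) atTop} = 0

def MaxCondWith {n : ℕ} (M : Set (Matrix (Fin n) (Fin n) ℝ))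
    (A : ℝ → Matrix (Fin n) (Fin n) ℝ) (x l : ℝ → Vec n) : Prop :=
  ∀ᵐ t ∂(volume.restrict (Set.Ici (0:ℝ))),
    ∀ B ∈ M, ⟪l t, mulE B (x t)⟫ ≤ ⟪l t, mulE (A t) (x t)⟫

def ConditionG {n : ℕ} (M : Set (Matrix (Fin n) (Fin n) ℝ)) : Prop :=
  ∀ (x₀ l₀ : Vec n), x₀ ≠ 0 → l₀ ≠ 0 →
  ∀ A₁ A₂ (x₁ x₂ l₁ l₂ : ℝ → Vec n),
    IsSolutionWith M A₁ x₁ → IsSolutionWith M A₂ x₂ →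
    IsAdjointWith A₁ l₁ → IsAdjointWith A₂ l₂ →
    x₁ 0 = x₀ → x₂ 0 = x₀ → l₁ 0 = l₀ → l₂ 0 = l₀ →
    MaxCondWith M A₁ x₁ l₁ → MaxCondWith M A₂ x₂ l₂ →
    ∀ t ≥ (0:ℝ), x₁ t = x₂ t ∧ l₁ t = l₂ t

def omegaLimitSet {n : ℕ} (x : ℝ → Vec n) : Set (Vec n) :=
  {p | ∃ tk : ℕ → ℝ, Tendsto tk atTop atTop ∧ Tendsto (fun k => x (tk k)) atTop (𝓝 p)}

/-- The bilinear map `(A, y) ↦ A y` is jointly continuous. -/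
theorem continuous_mulE {n : ℕ} :
    Continuous fun p : Matrix (Fin n) (Fin n) ℝ × Vec n => mulE p.1 p.2 := by
  have h : (fun p : Matrix (Fin n) (Fin n) ℝ × Vec n => mulE p.1 p.2) =
      fun p => WithLp.toLp 2 (p.1 *ᵥ WithLp.ofLp p.2) := by
    funext p
    rfl
  rw [h]
  have h2 : Continuous fun p : Matrix (Fin n) (Fin n) ℝ × Vec n => p.1 *ᵥ WithLp.ofLp p.2 :=
    Continuous.matrix_mulVec continuous_fst ((PiLp.continuous_ofLp 2 _).comp continuous_snd)
  exact (PiLp.continuous_toLp 2 _).comp h2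

theorem IsSolutionWith.exists_bound {n : ℕ} {M : Set (Matrix (Fin n) (Fin n) ℝ)}
    (hcpt : IsCompact M) {A : ℝ → Matrix (Fin n) (Fin n) ℝ} {x : ℝ → Vec n}
    (h : IsSolutionWith M A x) (T : ℝ) :
    ∃ K : ℝ, ∀ s ∈ Set.Icc 0 T, ‖mulE (A s) (x s)‖ ≤ K := by
  have hx : IsCompact (x '' Set.Icc 0 T) :=
    isCompact_Icc.image_of_continuousOn (h.2.2.1.mono Set.Icc_subset_Ici_self)
  obtain ⟨K, hK⟩ := ((hcpt.prod hx).image continuous_mulE).isBounded.exists_norm_le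
  exact ⟨K, fun s hs => hK _ ⟨(A s, x s), ⟨h.2.1 s, Set.mem_image_of_mem x hs⟩, rfl⟩⟩

theorem IsSolutionWith.integrableOn {n : ℕ} {M : Set (Matrix (Fin n) (Fin n) ℝ)}
    (hcpt : IsCompact M) {A : ℝ → Matrix (Fin n) (Fin n) ℝ} {x : ℝ → Vec n}
    (h : IsSolutionWith M A x) (T : ℝ) :
    IntegrableOn (fun s => mulE (A s) (x s)) (Set.Icc 0 T) := by
  obtain ⟨K, hK⟩ := h.exists_bound hcpt T
  have hx : AEMeasurable x (volume.restrict (Set.Icc 0 T)) :=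
    (h.2.2.1.mono Set.Icc_subset_Ici_self).aemeasurable measurableSet_Icc
  have hm : AEMeasurable (fun s => mulE (A s) (x s)) (volume.restrict (Set.Icc 0 T)) := by
    have hcoord : AEMeasurable (fun s => A s *ᵥ WithLp.ofLp (x s))
        (volume.restrict (Set.Icc 0 T)) := by
      refine aemeasurable_pi_lambda _ fun i => ?_
      simp only [Matrix.mulVec, dotProduct]
      refine Finset.aemeasurable_fun_sum _ fun j _ => ?_
      exact (h.1 i j).aemeasurable.mul
        ((PiLp.continuous_apply 2 _ j).measurable.comp_aemeasurable hx)
    exact (PiLp.continuous_toLp 2 _).measurable.comp_aemeasurable hcoord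
  refine IntegrableOn.of_bound (by simp) hm.aestronglyMeasurable K ?_
  exact (ae_restrict_iff' measurableSet_Icc).2 (Eventually.of_forall hK)

theorem IsSolutionWith.intervalIntegrable {n : ℕ} {M : Set (Matrix (Fin n) (Fin n) ℝ)}
    (hcpt : IsCompact M) {A : ℝ → Matrix (Fin n) (Fin n) ℝ} {x : ℝ → Vec n}
    (h : IsSolutionWith M A x) {a b : ℝ} (ha : 0 ≤ a) (hb : 0 ≤ b) :
    IntervalIntegrable (fun s => mulE (A s) (x s)) volume a b := by
  refine ((h.integrableOn hcpt (max a b)).mono_set ?_).intervalIntegrable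
  exact Set.Icc_subset_Icc (le_min ha hb) le_rfl

theorem IsSolutionWith.ae_hasDerivAt {n : ℕ} {M : Set (Matrix (Fin n) (Fin n) ℝ)}
    (hcpt : IsCompact M) {A : ℝ → Matrix (Fin n) (Fin n) ℝ} {x : ℝ → Vec n}
    (h : IsSolutionWith M A x) :
    ∀ᵐ t : ℝ, 0 < t → HasDerivAt x (mulE (A t) (x t)) t := by
  have key : ∀ᵐ t : ℝ, ∀ N : ℕ, t ∈ Set.uIcc (0 : ℝ) N → ∀ c ∈ Set.uIcc (0 : ℝ) N,
      HasDerivAt (fun r => ∫ s in c..r, mulE (A s) (x s)) (mulE (A t) (x t)) t :=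
    ae_all_iff.2 fun N =>
      (h.intervalIntegrable hcpt le_rfl N.cast_nonneg).ae_hasDerivAt_integral
  filter_upwards [key] with t ht hpos
  obtain ⟨N, hN⟩ := exists_nat_ge t
  have hd := ht N (by rw [Set.uIcc_of_le N.cast_nonneg]; exact ⟨hpos.le, hN⟩) 0 Set.left_mem_uIcc
  refine (hd.const_add (x 0)).congr_of_eventuallyEq ?_
  filter_upwards [Ioi_mem_nhds hpos] with s hs
  exact h.2.2.2 s (le_of_lt hs)

theorem IsSolutionWith.exists_lipschitzOnWith {n : ℕ} {M : Set (Matrix (Fin n) (Fin n) ℝ)}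
    (hcpt : IsCompact M) {A : ℝ → Matrix (Fin n) (Fin n) ℝ} {x : ℝ → Vec n}
    (h : IsSolutionWith M A x) (T : ℝ) : ∃ K, LipschitzOnWith K x (Set.Icc 0 T) := by
  obtain ⟨K, hK⟩ := h.exists_bound hcpt T
  refine ⟨K.toNNReal, LipschitzOnWith.of_dist_le_mul fun s hs t ht => ?_⟩
  have hsub : x s - x t = ∫ r in t..s, mulE (A r) (x r) := by
    rw [h.2.2.2 s hs.1, h.2.2.2 t ht.1, add_sub_add_left_eq_sub]
    exact intervalIntegral.integral_interval_sub_left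
      (h.intervalIntegrable hcpt le_rfl hs.1) (h.intervalIntegrable hcpt le_rfl ht.1)
  rw [dist_eq_norm, hsub, Real.dist_eq]
  refine (intervalIntegral.norm_integral_le_of_norm_le_const fun r hr => hK r ?_).trans
    (mul_le_mul_of_nonneg_right (Real.le_coe_toNNReal K) (abs_nonneg _))
  exact Set.uIcc_subset_Icc ht hs (Set.uIoc_subset_uIcc hr)

theorem IsNorm.neg {n : ℕ} {v : Vec n → ℝ} (hv : IsNorm v) (x : Vec n) : v (-x) = v x := by
  simpa using hv.2.1 (-1) x

theorem IsNorm.nonneg {n : ℕ} {v : Vec n → ℝ} (hv : IsNorm v) (x : Vec n) : 0 ≤ v x := by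
  have h := hv.2.2 x (-x)
  rw [add_neg_cancel, (hv.1 0).2 rfl, hv.neg] at h
  linarith

theorem IsNorm.exists_le_mul_norm {n : ℕ} {v : Vec n → ℝ} (hv : IsNorm v) :
    ∃ C : NNReal, ∀ x, v x ≤ C * ‖x‖ := by
  let b := EuclideanSpace.basisFun (Fin n) ℝ
  refine ⟨∑ i, (v (b i)).toNNReal, fun x => ?_⟩
  have h1 : v x ≤ ∑ i, v (x i • b i) := by
    conv_lhs => rw [← b.sum_repr x]
    exact Finset.le_sum_of_subadditive v ((hv.1 0).2 rfl).le hv.2.2 _ _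
  refine h1.trans ?_
  push_cast
  rw [Finset.sum_mul]
  refine Finset.sum_le_sum fun i _ => ?_
  rw [hv.2.1, mul_comm, Real.coe_toNNReal _ (hv.nonneg _)]
  exact mul_le_mul_of_nonneg_left (PiLp.norm_apply_le x i) (hv.nonneg _)

theorem IsNorm.exists_lipschitzWith {n : ℕ} {v : Vec n → ℝ} (hv : IsNorm v) :
    ∃ C, LipschitzWith C v := by
  obtain ⟨C, hC⟩ := hv.exists_le_mul_norm
  refine ⟨C, LipschitzWith.of_le_add_mul C fun x y => ?_⟩
  have h := hv.2.2 y (x - y)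
  rw [add_sub_cancel] at h
  rw [dist_eq_norm]
  linarith [hC (x - y)]

/-- Hahn–Banach: the subdifferential of a norm is nonempty at every point. -/
theorem IsNorm.subdiff_nonempty {n : ℕ} {v : Vec n → ℝ} (hv : IsNorm v) (y : Vec n) :
    (subdiff v y).Nonempty := by
  by_cases hy : y = 0
  · refine ⟨0, ?_, fun z => ?_⟩
    · rw [hy, inner_zero_left, (hv.1 0).2 rfl]
    · rw [inner_zero_left]
      exact hv.nonneg z
  obtain ⟨g, hg, hle⟩ := exists_extension_of_le_sublinear
    (LinearPMap.mkSpanSingleton y (v y) hy) v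
    (fun c hc z => by rw [hv.2.1, abs_of_pos hc]) hv.2.2 (by
      rintro ⟨z, hz⟩
      obtain ⟨c, rfl⟩ := Submodule.mem_span_singleton.1 hz
      refine (LinearPMap.mkSpanSingleton'_apply y (v y) _ c hz).trans_le ?_
      rw [hv.2.1, smul_eq_mul]
      exact mul_le_mul_of_nonneg_right (le_abs_self c) (hv.nonneg y))
  have hinner : ∀ z, ⟪(InnerProductSpace.toDual ℝ (Vec n)).symm g.toContinuousLinearMap, z⟫ = g z :=
    fun z => by rw [InnerProductSpace.toDual_symm_apply]; rfl
  refine ⟨(InnerProductSpace.toDual ℝ (Vec n)).symm g.toContinuousLinearMap, ?_, fun z => ?_⟩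
  · rw [hinner]
    exact (hg ⟨y, Submodule.mem_span_singleton_self y⟩).trans
      (LinearPMap.mkSpanSingleton_apply ℝ ℝ hy (v y))
  · rw [hinner]
    exact hle z

/-- A constant switching signal produces the exponential flow. -/
theorem exists_isSolution_hasDerivAt {n : ℕ} {M : Set (Matrix (Fin n) (Fin n) ℝ)}
    {B : Matrix (Fin n) (Fin n) ℝ} (hB : B ∈ M) (y : Vec n) :
    ∃ z : ℝ → Vec n, IsSolution M z ∧ z 0 = y ∧ HasDerivAt z (mulE B y) 0 := by
  let L : Vec n →L[ℝ] Vec n := LinearMap.toContinuousLinearMap (Matrix.toEuclideanLin B)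
  let z : ℝ → Vec n := fun t => NormedSpace.exp (t • L) y
  have hz0 : z 0 = y := by
    change NormedSpace.exp ((0 : ℝ) • L) y = y
    have h0 : (0 : ℝ) • L = 0 := zero_smul ℝ L
    rw [h0, NormedSpace.exp_zero]
    rfl
  have hz : ∀ t, HasDerivAt z (mulE B (z t)) t := fun t => by
    have h := (hasDerivAt_exp_smul_const' L t).clm_apply (hasDerivAt_const t y)
    rw [map_zero, add_zero] at h
    exact h
  have hzc : Continuous z := continuous_iff_continuousAt.2 fun t => (hz t).continuousAt
  have hBz : Continuous fun t => mulE B (z t) := L.continuous.comp hzc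
  refine ⟨z, ⟨fun _ => B, fun i j => measurable_const, fun _ => hB, hzc.continuousOn,
    fun t _ => ?_⟩, hz0, by simpa only [hz0] using hz 0⟩
  rw [intervalIntegral.integral_eq_sub_of_hasDerivAt (fun s _ => hz s)
    (hBz.intervalIntegrable 0 t), add_sub_cancel]

theorem IsBarabanov.inner_mulE_nonpos {n : ℕ} {M : Set (Matrix (Fin n) (Fin n) ℝ)}
    {v : Vec n → ℝ} (hv : IsBarabanov M v) {y l : Vec n} (hl : l ∈ subdiff v y)
    {B : Matrix (Fin n) (Fin n) ℝ} (hB : B ∈ M) : ⟪l, mulE B y⟫ ≤ 0 := by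
  obtain ⟨z, hz, hz0, hd⟩ := exists_isSolution_hasDerivAt hB y
  have hd' : HasDerivAt (fun t => ⟪l, z t⟫) ⟪l, mulE B y⟫ 0 := by
    simpa using (hasDerivAt_const (0 : ℝ) l).inner ℝ hd
  refine le_of_tendsto hd'.tendsto_slope_zero_right ?_
  filter_upwards [self_mem_nhdsWithin] with t ht
  have ht : 0 < t := ht
  have h1 := hv.2.1 z hz t ht.le
  have h2 := hl.2 (z t)
  rw [zero_add, hz0, hl.1, smul_eq_mul]
  rw [hz0] at h1
  exact mul_nonpos_of_nonneg_of_nonpos (inv_nonneg.2 ht.le) (by linarith)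

/-- At a time where both the solution and `v` along it are differentiable, the derivative of the
latter is given by any subgradient. -/
theorem subdiff.deriv_eq {n : ℕ} {v : Vec n → ℝ} {x : ℝ → Vec n} {l x' : Vec n} {t d : ℝ}
    (hl : l ∈ subdiff v (x t)) (hx : HasDerivAt x x' t) (hvx : HasDerivAt (fun s => v (x s)) d t) :
    d = ⟪l, x'⟫ := by
  have hlx : HasDerivAt (fun s => ⟪l, x s⟫) ⟪l, x'⟫ t := by
    simpa using (hasDerivAt_const t l).inner ℝ hx
  have hmin : IsLocalMin (fun s => v (x s) - ⟪l, x s⟫) t :=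
    Eventually.of_forall fun s => by
      have h1 := hl.1
      have h2 := hl.2 (x s)
      dsimp only
      linarith
  linarith [hmin.hasDerivAt_eq_zero (hvx.fun_sub hlx)]

theorem stmt12 (n : ℕ) (hn : 0 < n) (M : Set (Matrix (Fin n) (Fin n) ℝ))
    (hne : M.Nonempty) (hcpt : IsCompact M) (hconv : Convex ℝ M)
    (v : Vec n → ℝ) (hv : IsBarabanov M v)
    (x : ℝ → Vec n) (hx : IsSolution M x) :
    (∀ t ≥ (0:ℝ), v (x t) = v (x 0)) ↔
      ∃ A : ℝ → Matrix (Fin n) (Fin n) ℝ, IsSolutionWith M A x ∧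
        ∀ᵐ t ∂(volume.restrict (Set.Ici (0:ℝ))),
          ∃ l ∈ subdiff v (x t), ⟪l, mulE (A t) (x t)⟫ = 0 ∧
            ∀ B ∈ M, ⟪l, mulE B (x t)⟫ ≤ 0 := by
  constructor
  · intro hconst
    obtain ⟨A, hA⟩ := hx
    refine ⟨A, hA, (ae_restrict_iff' measurableSet_Ici).2 ?_⟩
    filter_upwards [hA.ae_hasDerivAt hcpt, Measure.ae_ne volume 0] with t hd ht0 ht
    have hpos : 0 < t := lt_of_le_of_ne ht ht0.symm
    obtain ⟨l, hl⟩ := hv.1.subdiff_nonempty (x t)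
    have hvx : HasDerivAt (fun s => v (x s)) 0 t := by
      refine (hasDerivAt_const t (v (x 0))).congr_of_eventuallyEq ?_
      filter_upwards [Ioi_mem_nhds hpos] with s hs
      exact hconst s (le_of_lt hs)
    exact ⟨l, hl, (subdiff.deriv_eq hl (hd hpos) hvx).symm, fun B hB => hv.inner_mulE_nonpos hl hB⟩
  · rintro ⟨A, hA, hae⟩ T hT
    obtain ⟨K, hK⟩ := hA.exists_lipschitzOnWith hcpt T
    obtain ⟨C, hC⟩ := hv.1.exists_lipschitzWith
    have hac : AbsolutelyContinuousOnInterval (fun s => v (x s)) 0 T := by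
      refine LipschitzOnWith.absolutelyContinuousOnInterval (K := C * K) ?_
      rw [Set.uIcc_of_le hT]
      exact hC.comp_lipschitzOnWith hK
    have hae' := (ae_restrict_iff' measurableSet_Ici).1 hae
    obtain ⟨c, hc⟩ := hac.const_of_ae_hasDerivAt_zero (by
      filter_upwards [hA.ae_hasDerivAt hcpt, Measure.ae_ne volume 0, hac.ae_differentiableAt, hae']
        with t hd ht0 hdiff hl ht
      have hnonneg : 0 ≤ t := (Set.uIcc_of_le hT ▸ ht).1
      obtain ⟨l, hl, hlA, -⟩ := hl hnonneg
      have hder := (hdiff ht).hasDerivAt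
      have h0 := subdiff.deriv_eq hl (hd (lt_of_le_of_ne hnonneg ht0.symm)) hder
      rwa [h0, hlA] at hder)
    rw [hc T Set.right_mem_uIcc, hc 0 Set.left_mem_uIcc]
end
end

section
/- Let A be a real 3×3 matrix and b, c ∈ ℝ³ be such that both A and A + b·cᵀ are Hurwitz. Then for every u ∈ [0,1] the matrix A + u·b·cᵀ is invertible, and 1 + bᵀ(Aᵀ)⁻¹c > 0. -/
open Matrix

noncomputable section

/-- A real matrix is Hurwitz if all its complex eigenvalues have negative real part. -/
def IsHurwitz (A : Matrix (Fin 3) (Fin 3) ℝ) : Prop :=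
  ∀ μ : ℂ, (A.map (fun r => (r : ℂ))).charpoly.IsRoot μ → μ.re < 0

/-- A Hurwitz real matrix of size three has negative determinant. -/
theorem IsHurwitz.det_neg {A : Matrix (Fin 3) (Fin 3) ℝ} (hA : IsHurwitz A) : A.det < 0 := by
  have hroot : ∀ x : ℝ, 0 ≤ x → A.charpoly.eval x ≠ 0 := by
    intro x hx h
    refine (hA x ?_).not_ge (by simpa using hx)
    have hmap : (A.map (fun r => (r : ℂ))).charpoly = A.charpoly.map Complex.ofRealHom :=
      A.charpoly_map Complex.ofRealHom
    rw [hmap]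
    exact Polynomial.IsRoot.map h
  have hzero : A.charpoly.eval 0 = -A.det := by
    rw [det_eq_sign_charpoly_coeff, Polynomial.coeff_zero_eq_eval_zero]
    norm_num [pow_succ]
  by_contra! hdet
  have htop : Filter.Tendsto (fun x => A.charpoly.eval x) Filter.atTop Filter.atTop := by
    refine A.charpoly.tendsto_atTop_of_leadingCoeff_nonneg ?_ ?_
    · rw [A.charpoly_degree_eq_dim]
      norm_num
    · rw [A.charpoly_monic.leadingCoeff]
      exact zero_le_one
  obtain ⟨y, hy, hy0⟩ :=
    ((htop.eventually_ge_atTop 0).and (Filter.eventually_ge_atTop 0)).exists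
  obtain ⟨x, hx, hx0⟩ := intermediate_value_Icc hy0 A.charpoly.continuous.continuousOn
    (show (0 : ℝ) ∈ Set.Icc _ _ from ⟨by linarith, hy⟩)
  exact hroot x hx.1 hx0

theorem det_add_smul_vecMulVec_fin_three (A : Matrix (Fin 3) (Fin 3) ℝ) (b c : Fin 3 → ℝ) (u : ℝ) :
    (A + u • vecMulVec b c).det = A.det + u * (b ⬝ᵥ Aᵀ.adjugate.mulVec c) := by
  rw [adjugate_fin_three]
  simp [det_fin_three, vecMulVec_apply, dotProduct, mulVec, Fin.sum_univ_three]
  ring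

theorem stmt14 (A : Matrix (Fin 3) (Fin 3) ℝ) (b c : Fin 3 → ℝ)
    (hA : IsHurwitz A) (hAbc : IsHurwitz (A + vecMulVec b c)) :
    (∀ u ∈ Set.Icc (0:ℝ) 1, IsUnit (A + u • vecMulVec b c)) ∧
      0 < 1 + b ⬝ᵥ (Aᵀ)⁻¹.mulVec c := by
  have hdet := hA.det_neg
  have hdet' := hAbc.det_neg
  have hone := det_add_smul_vecMulVec_fin_three A b c 1
  rw [one_smul, one_mul] at hone
  rw [hone] at hdet'
  constructor
  · rintro u ⟨hu0, hu1⟩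
    rw [isUnit_iff_isUnit_det, isUnit_iff_ne_zero, det_add_smul_vecMulVec_fin_three]
    refine ne_of_lt ?_
    rcases hu1.lt_or_eq with hu1 | rfl
    · nlinarith
    · linarith
  · rw [inv_def, det_transpose, Ring.inverse_eq_inv', smul_mulVec, dotProduct_smul, smul_eq_mul]
    have hfactor : 1 + A.det⁻¹ * (b ⬝ᵥ Aᵀ.adjugate.mulVec c) =
        A.det⁻¹ * (A.det + b ⬝ᵥ Aᵀ.adjugate.mulVec c) := by
      rw [mul_add, inv_mul_cancel₀ hdet.ne]
    rw [hfactor]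
    exact mul_pos_of_neg_of_neg (inv_lt_zero.mpr hdet) hdet'
end
end
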